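/- Let n ≥ 1 and suppose the N nonzero vectors 𝒞 = (C₁,…,C_N) in V satisfy the incidence conditions (I.1), (I.2), (I.3). Fix an index j ∈ {1,…,N}. Then for every negative vector v ∈ V (i.e., B(v,v) < 0) with B(v,C_j) = 0, one has sgn(B(v,C_{j−1}))·sgn(B(v,C_{j+1})) < 0; equivalently, B(v,C_{j−1})·B(v,C_{j+1}) < 0. -/

import Mathlib

/-- The bilinear form of signature (n,2) on ℝ^(n+2): first two coordinates negative. -/
noncomputable def B (n : ℕ) (x y : Fin (n + 2) → ℝ) : ℝ :=
  ∑ i : Fin (n + 2), (if (i : ℕ) < 2 then -1 else 1) * (x i * y i)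

/-- w(x;𝒞) = ∑_j sgn(B(x,C_j)) sgn(B(x,C_{j+1})), with cyclic indexing. -/
noncomputable def wt (n N : ℕ) [NeZero N] (C : Fin N → (Fin (n + 2) → ℝ))
    (x : Fin (n + 2) → ℝ) : ℝ :=
  ∑ j : Fin N, Real.sign (B n x (C j)) * Real.sign (B n x (C (j + 1)))

/-- Incidence condition (I.1). -/
def I1 (n N : ℕ) (C : Fin N → (Fin (n + 2) → ℝ)) : Prop :=
  ∀ j, B n (C j) (C j) ≤ 0

/-- Incidence condition (I.2). -/
def I2 (n N : ℕ) [NeZero N] (C : Fin N → (Fin (n + 2) → ℝ)) : Prop :=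
  ∀ j : Fin N,
    (B n (C j) (C j) * B n (C (j + 1)) (C (j + 1)) > 0 →
      B n (C j) (C j) * B n (C (j + 1)) (C (j + 1)) - (B n (C j) (C (j + 1))) ^ 2 > 0) ∧
    (B n (C j) (C j) * B n (C (j + 1)) (C (j + 1)) = 0 →
      B n (C j) (C j) * B n (C (j + 1)) (C (j + 1)) - (B n (C j) (C (j + 1))) ^ 2 = 0)

/-- Incidence condition (I.3). -/
def I3 (n N : ℕ) [NeZero N] (C : Fin N → (Fin (n + 2) → ℝ)) : Prop :=
  ∀ j : Fin N,
    (B n (C j) (C j) < 0 →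
      B n (C j) (C j) * B n (C (j - 1)) (C (j + 1)) -
        B n (C j) (C (j - 1)) * B n (C j) (C (j + 1)) < 0) ∧
    (B n (C j) (C j) = 0 → B n (C (j - 1)) (C (j + 1)) > 0)

lemma B_comm (n : ℕ) (x y : Fin (n + 2) → ℝ) : B n x y = B n y x := by
  simp only [B, mul_comm (x _)]

lemma B_add_left (n : ℕ) (x y z : Fin (n + 2) → ℝ) : B n (x + y) z = B n x z + B n y z := by
  simp only [B, ← Finset.sum_add_distrib, Pi.add_apply]
  exact Finset.sum_congr rfl fun i _ => by ring

lemma B_smul_left (n : ℕ) (r : ℝ) (x z : Fin (n + 2) → ℝ) : B n (r • x) z = r * B n x z := by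
  simp only [B, Finset.mul_sum, Pi.smul_apply, smul_eq_mul]
  exact Finset.sum_congr rfl fun i _ => by ring

lemma B_add_right (n : ℕ) (x y z : Fin (n + 2) → ℝ) : B n z (x + y) = B n z x + B n z y := by
  rw [B_comm, B_add_left, B_comm n x, B_comm n y]

lemma B_smul_right (n : ℕ) (r : ℝ) (x z : Fin (n + 2) → ℝ) : B n z (r • x) = r * B n z x := by
  rw [B_comm, B_smul_left, B_comm n x]

lemma B_self_eq_sum (n : ℕ) {x : Fin (n + 2) → ℝ} (h0 : x 0 = 0) (h1 : x 1 = 0) :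
    B n x x = ∑ i : Fin n, x i.succ.succ ^ 2 := by
  have hsucc : x (Fin.succ 0) = 0 := h1
  simp only [B, Fin.sum_univ_succ, h0, hsucc]
  simp [sq]

/-- The form is positive definite on vectors whose first two coordinates vanish. -/
lemma eq_zero_of_B_self_nonpos (n : ℕ) {x : Fin (n + 2) → ℝ} (h0 : x 0 = 0) (h1 : x 1 = 0)
    (hx : B n x x ≤ 0) : x = 0 := by
  rw [B_self_eq_sum n h0 h1] at hx
  have hsum := le_antisymm hx (Finset.sum_nonneg fun i _ => sq_nonneg _)
  rw [Finset.sum_eq_zero_iff_of_nonneg fun i _ => sq_nonneg _] at hsum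
  funext i
  refine Fin.cases h0 (fun i => ?_) i
  induction i using Fin.cases with
  | zero => exact h1
  | succ i => exact pow_eq_zero_iff two_ne_zero |>.1 (hsum i (Finset.mem_univ i))

/-- Three vectors have a nontrivial combination killing the first two coordinates. -/
lemma exists_combination_coord_eq_zero (n : ℕ) (x v c : Fin (n + 2) → ℝ) :
    ∃ s t u : ℝ, (s ≠ 0 ∨ t ≠ 0 ∨ u ≠ 0) ∧
      (s • x + t • v + u • c) 0 = 0 ∧ (s • x + t • v + u • c) 1 = 0 := by
  obtain ⟨w, hw, hM⟩ := Matrix.exists_mulVec_eq_zero_iff (M :=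
    !![x 0, v 0, c 0; x 1, v 1, c 1; 0, 0, 0]) |>.2 (by simp [Matrix.det_fin_three])
  have e0 := congrFun hM 0
  have e1 := congrFun hM 1
  simp [Matrix.mulVec, dotProduct, Fin.sum_univ_three] at e0 e1
  refine ⟨w 0, w 1, w 2, ?_, ?_, ?_⟩
  · by_contra! h
    exact hw (funext fun i => by fin_cases i <;> simp [h])
  · simp only [Pi.add_apply, Pi.smul_apply, smul_eq_mul]; linarith
  · simp only [Pi.add_apply, Pi.smul_apply, smul_eq_mul]; linarith

/-- The form is positive semidefinite on the orthogonal complement of a negative vector `v` and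
a nonzero nonpositive vector `c` orthogonal to `v`. -/
lemma B_self_nonneg_of_orthogonal (n : ℕ) {v c x : Fin (n + 2) → ℝ} (hv : B n v v < 0)
    (hc : B n c c ≤ 0) (hc0 : c ≠ 0) (hvc : B n v c = 0) (hvx : B n v x = 0)
    (hcx : B n c x = 0) : 0 ≤ B n x x := by
  by_contra! hx
  obtain ⟨s, t, u, hne, h0, h1⟩ := exists_combination_coord_eq_zero n x v c
  have hself : B n (s • x + t • v + u • c) (s • x + t • v + u • c) =
      s ^ 2 * B n x x + t ^ 2 * B n v v + u ^ 2 * B n c c := by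
    simp only [B_add_left, B_smul_left, B_add_right, B_smul_right, B_comm n x v, B_comm n x c,
      B_comm n c v, hvc, hvx, hcx]
    ring
  have hs := mul_nonpos_of_nonneg_of_nonpos (sq_nonneg s) hx.le
  have ht := mul_nonpos_of_nonneg_of_nonpos (sq_nonneg t) hv.le
  have hu := mul_nonpos_of_nonneg_of_nonpos (sq_nonneg u) hc
  have hzero := eq_zero_of_B_self_nonpos n h0 h1 (by linarith)
  rw [hzero] at hself
  have hB0 : B n 0 0 = 0 := by simp [B]
  have hs0 : s = 0 := by
    have : s ^ 2 * B n x x = 0 := by linarith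
    simpa [hx.ne] using this
  have ht0 : t = 0 := by
    have : t ^ 2 * B n v v = 0 := by linarith
    simpa [hv.ne] using this
  simp_all

/-- A causal vector orthogonal to `v` and `c` pairs to zero with everything orthogonal to `c`. -/
lemma B_eq_zero_of_orthogonal (n : ℕ) {v c a b : Fin (n + 2) → ℝ} (hv : B n v v < 0)
    (hc : B n c c ≤ 0) (hc0 : c ≠ 0) (hvc : B n v c = 0) (hca : B n c a = 0)
    (hcb : B n c b = 0) (ha : B n a a ≤ 0) (hva : B n v a = 0) : B n a b = 0 := by
  by_contra hab
  have ha0 := le_antisymm ha (B_self_nonneg_of_orthogonal n hv hc hc0 hvc hva hca)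
  set y := B n v v • b + (-B n v b) • v with hy
  have hay : B n a y = B n v v * B n a b := by
    simp only [hy, B_add_right, B_smul_right, B_comm n a v, hva]; ring
  have hvy : B n v y = 0 := by simp only [hy, B_add_right, B_smul_right]; ring
  have hcy : B n c y = 0 := by
    simp only [hy, B_add_right, B_smul_right, B_comm n c v, hcb, hvc]; ring
  have hay0 : B n a y ≠ 0 := hay ▸ mul_ne_zero hv.ne hab
  set t := -(B n y y + 1) / (2 * B n a y) with ht
  have hnonneg := B_self_nonneg_of_orthogonal n (x := t • a + y) hv hc hc0 hvc
    (by simp [B_add_right, B_smul_right, hva, hvy])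
    (by simp [B_add_right, B_smul_right, hca, hcy])
  have hself : B n (t • a + y) (t • a + y) = t * (2 * B n a y) + B n y y := by
    simp only [B_add_left, B_smul_left, B_add_right, B_smul_right, B_comm n y a, ha0]; ring
  have hcancel : t * (2 * B n a y) = -(B n y y + 1) := by rw [ht]; field_simp
  linarith

/-- Causal vectors orthogonal to `c` that pair positively lie on opposite sides
of the hyperplane orthogonal to `v`. -/
lemma B_mul_B_neg_of_pairing_pos (n : ℕ) {v c a b : Fin (n + 2) → ℝ} (hv : B n v v < 0)
    (hc : B n c c ≤ 0) (hc0 : c ≠ 0) (hvc : B n v c = 0) (hca : B n c a = 0)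
    (hcb : B n c b = 0) (ha : B n a a ≤ 0) (hb : B n b b ≤ 0) (hab : 0 < B n a b) :
    B n v a * B n v b < 0 := by
  by_contra! hmul
  have hva : B n v a ≠ 0 := fun h =>
    hab.ne' (B_eq_zero_of_orthogonal n hv hc hc0 hvc hca hcb ha h)
  have hvb : B n v b ≠ 0 := fun h =>
    hab.ne' (B_comm n b a ▸ B_eq_zero_of_orthogonal n hv hc hc0 hvc hcb hca hb h)
  have hpos : 0 < B n v a * B n v b := lt_of_le_of_ne hmul (mul_ne_zero hva hvb).symm
  have hnonneg := B_self_nonneg_of_orthogonal n (x := B n v b • a + (-B n v a) • b) hv hc hc0 hvc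
    (by simp only [B_add_right, B_smul_right]; ring)
    (by simp only [B_add_right, B_smul_right, hca, hcb]; ring)
  have hself : B n (B n v b • a + (-B n v a) • b) (B n v b • a + (-B n v a) • b) =
      B n v b ^ 2 * B n a a + B n v a ^ 2 * B n b b - 2 * (B n v a * B n v b * B n a b) := by
    simp only [B_add_left, B_smul_left, B_add_right, B_smul_right, B_comm n b a]; ring
  have hterm_a := mul_nonpos_of_nonneg_of_nonpos (sq_nonneg (B n v b)) ha
  have hterm_b := mul_nonpos_of_nonneg_of_nonpos (sq_nonneg (B n v a)) hb
  have hterm_ab := mul_pos hpos hab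
  linarith

lemma gram_nonneg {p q r : ℝ} (hp : p ≤ 0) (hq : q ≤ 0)
    (hpos : p * q > 0 → p * q - r ^ 2 > 0) (hzero : p * q = 0 → p * q - r ^ 2 = 0) :
    0 ≤ p * q - r ^ 2 := by
  rcases (mul_nonneg_of_nonpos_of_nonpos hp hq).lt_or_eq with h | h
  · exact (hpos h).le
  · exact (hzero h.symm).ge

lemma sign_mul_sign_neg {p q : ℝ} (h : p * q < 0) : Real.sign p * Real.sign q < 0 := by
  rcases mul_neg_iff.1 h with ⟨hp, hq⟩ | ⟨hp, hq⟩
  · simp [Real.sign_of_pos hp, Real.sign_of_neg hq]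
  · simp [Real.sign_of_neg hp, Real.sign_of_pos hq]

/-- under (I.1)-(I.3), for a negative vector v orthogonal to C_j,
sgn(B(v,C_{j-1}))·sgn(B(v,C_{j+1})) < 0, equivalently B(v,C_{j-1})·B(v,C_{j+1}) < 0. -/
theorem sign_product_negative_of_orthogonal (n N : ℕ) (hn : 1 ≤ n) [NeZero N]
    (C : Fin N → (Fin (n + 2) → ℝ)) (hC : ∀ j, C j ≠ 0)
    (h1 : I1 n N C) (h2 : I2 n N C) (h3 : I3 n N C)
    (j : Fin N) (v : Fin (n + 2) → ℝ) (hvneg : B n v v < 0)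
    (hperp : B n v (C j) = 0) :
    Real.sign (B n v (C (j - 1))) * Real.sign (B n v (C (j + 1))) < 0 ∧
      B n v (C (j - 1)) * B n v (C (j + 1)) < 0 := by
  have hgram_a : 0 ≤ B n (C j) (C j) * B n (C (j - 1)) (C (j - 1)) -
      B n (C j) (C (j - 1)) ^ 2 := by
    have h := h2 (j - 1)
    rw [sub_add_cancel] at h
    rw [mul_comm, B_comm n (C j) (C (j - 1))]
    exact gram_nonneg (h1 _) (h1 _) h.1 h.2
  have hgram_b : 0 ≤ B n (C j) (C j) * B n (C (j + 1)) (C (j + 1)) - B n (C j) (C (j + 1)) ^ 2 :=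
    gram_nonneg (h1 _) (h1 _) (h2 j).1 (h2 j).2
  have ha := h1 (j - 1)
  have hb := h1 (j + 1)
  have hc := h1 j
  have hc0 := hC j
  obtain ⟨h3neg, h3zero⟩ := h3 j
  generalize C (j - 1) = a at *
  generalize C (j + 1) = b at *
  generalize C j = c at *
  suffices h : B n v a * B n v b < 0 from ⟨sign_mul_sign_neg h, h⟩
  rcases hc.lt_or_eq with hneg | hnull
  · have horth (x) : B n c (B n c c • x + (-B n c x) • c) = 0 := by
      simp only [B_add_right, B_smul_right]; ring
    have hpair (x y) : B n (B n c c • x + (-B n c x) • c) (B n c c • y + (-B n c y) • c) =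
        B n c c * (B n c c * B n x y - B n c x * B n c y) := by
      simp only [B_add_left, B_smul_left, B_add_right, B_smul_right, B_comm n x c]; ring
    have hv (x) : B n v (B n c c • x + (-B n c x) • c) = B n c c * B n v x := by
      simp only [B_add_right, B_smul_right, hperp]; ring
    have h := B_mul_B_neg_of_pairing_pos n hvneg hc hc0 hperp (horth a) (horth b)
      (by rw [hpair, ← sq]; exact mul_nonpos_of_nonpos_of_nonneg hc hgram_a)
      (by rw [hpair, ← sq]; exact mul_nonpos_of_nonpos_of_nonneg hc hgram_b)
      (by rw [hpair]; exact mul_pos_of_neg_of_neg hneg (h3neg hneg))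
    rw [hv, hv, mul_mul_mul_comm] at h
    exact neg_of_mul_neg_right h (mul_self_nonneg _)
  · rw [hnull, zero_mul, zero_sub, neg_nonneg] at hgram_a hgram_b
    exact B_mul_B_neg_of_pairing_pos n hvneg hc hc0 hperp (sq_nonpos_iff _ |>.1 hgram_a)
      (sq_nonpos_iff _ |>.1 hgram_b) ha hb (h3zero hnull)
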